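/- Let G be a finite 2-group with exactly 5 cyclic subgroups. Then G is isomorphic to the quaternion group Q_8 or to the cyclic group C_{16}. -/

import Mathlib

open Finset in
/-- The elements of order `d` are partitioned by the cyclic subgroups of order `d`, each of which
has `φ d` generators. -/
theorem card_orderOf_eq_totient_mul_card_zpowers {G : Type*} [Group G] [Fintype G]
    [DecidableEq (Subgroup G)] (d : ℕ) :
    #{g : G | orderOf g = d} =
      d.totient * #((univ.image Subgroup.zpowers).filter fun H : Subgroup G => Nat.card H = d) := by
  classical
  rw [card_eq_sum_card_fiberwise (f := Subgroup.zpowers)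
    (t := (univ.image Subgroup.zpowers).filter fun H : Subgroup G => Nat.card H = d),
    sum_const_nat (m := d.totient), mul_comm]
  · intro H hH
    simp only [mem_filter, mem_image, mem_univ, true_and] at hH
    obtain ⟨⟨g, rfl⟩, hd⟩ := hH
    have hcyc := IsCyclic.card_orderOf_eq_totient (α := Subgroup.zpowers g) (d := d)
      (by rw [← Nat.card_eq_fintype_card, hd])
    rw [← hcyc]
    symm
    refine card_bij (fun x _ => (x : G)) ?_ ?_ ?_
    · intro x hx
      simp only [mem_filter, mem_univ, true_and] at hx ⊢
      refine ⟨by simp [hx], ?_⟩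
      apply Subgroup.eq_of_le_of_card_ge
      · simp
      · rw [hd, Nat.card_zpowers, Subgroup.orderOf_coe, hx]
    · intro x _ y _ hxy
      exact Subtype.ext hxy
    · intro x hx
      simp only [mem_filter, mem_univ, true_and] at hx
      refine ⟨⟨x, hx.2 ▸ Subgroup.mem_zpowers x⟩, ?_, rfl⟩
      rw [mem_filter, ← Subgroup.orderOf_coe]
      exact ⟨mem_univ _, hx.1⟩
  · intro g hg
    simpa [-Nat.card_eq_fintype_card, Nat.card_zpowers] using hg

/-- A group of order eight with an element `x` of order four outside of whose cyclic subgroup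
every square is `x ^ 2` is the quaternion group. -/
theorem nonempty_mulEquiv_quaternionGroup_two {G : Type*} [Group G] [Finite G]
    (hG : Nat.card G = 8) {x : G} (hx : orderOf x = 4)
    (hsq : ∀ y ∉ Subgroup.zpowers x, y ^ 2 = x ^ 2) :
    Nonempty (G ≃* QuaternionGroup 2) := by
  obtain ⟨y, hy⟩ : ∃ y, y ∉ Subgroup.zpowers x := by
    by_contra! hall
    have := orderOf_eq_card_of_forall_mem_zpowers hall
    omega
  have hx4 : x ^ 4 = 1 := hx ▸ pow_orderOf_eq_one x
  have hyy : y * y = x ^ 2 := by rw [← hsq y hy, pow_two]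
  have hxy : x * y ∉ Subgroup.zpowers x := by
    rwa [Subgroup.mul_mem_cancel_left _ (Subgroup.mem_zpowers x)]
  have hyxy : y * x * y = x := by
    have h := hsq _ hxy
    rw [pow_two, pow_two, mul_assoc] at h
    rw [mul_assoc]
    exact mul_left_cancel h
  have hcomm : x * y = y * x ^ 3 := by
    calc x * y = (y * x * y) * y := by rw [hyxy]
      _ = y * x * (y * y) := by group
      _ = y * x ^ 3 := by rw [hyy]; group
  have hadd (i j : ZMod (2 * 2)) : x ^ (i + j).val = x ^ i.val * x ^ j.val := by
    rw [ZMod.val_add, ← pow_add]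
    conv_rhs => rw [← pow_mod_orderOf, hx]
  have hcomm_pow (i : ZMod (2 * 2)) : x ^ i.val * y = y * x ^ (-i).val := by
    have hn (n : ℕ) : x ^ n * y = y * x ^ (3 * n) := by
      induction n with
      | zero => simp
      | succ n ih =>
        rw [pow_succ, mul_assoc, hcomm, ← mul_assoc, ih, mul_assoc, ← pow_add]
        congr 2
    rw [hn, ← pow_mod_orderOf x (3 * i.val), hx]
    congr 2
    revert i
    decide
  let f : QuaternionGroup 2 →* G := MonoidHom.mk'
    (fun q => match q with
      | .a i => x ^ i.val
      | .xa i => y * x ^ i.val) (by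
    rintro (i | i) (j | j)
    · simp [hadd]
    · simp only [QuaternionGroup.a_mul_xa]
      rw [sub_eq_neg_add, hadd, ← mul_assoc, ← mul_assoc, hcomm_pow]
    · simp only [QuaternionGroup.xa_mul_a, hadd, mul_assoc]
    · simp only [QuaternionGroup.xa_mul_xa]
      have h2 : x ^ ((2 : ℕ) : ZMod (2 * 2)).val = x ^ 2 := rfl
      rw [add_sub_assoc, sub_eq_neg_add, hadd, hadd, h2, ← hyy, mul_assoc y (x ^ i.val),
        ← mul_assoc (x ^ i.val), hcomm_pow]
      simp only [mul_assoc])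
  have hf : Function.Injective f := by
    rw [injective_iff_map_eq_one]
    rintro (i | i) hi
    · change x ^ i.val = 1 at hi
      have hdvd := orderOf_dvd_of_pow_eq_one hi
      rw [hx] at hdvd
      have hlt : i.val < 4 := ZMod.val_lt i
      have h0 : i.val = 0 := Nat.eq_zero_of_dvd_of_lt hdvd hlt
      rw [(ZMod.val_eq_zero i).1 h0, QuaternionGroup.a_zero]
    · change y * x ^ i.val = 1 at hi
      refine absurd ?_ hy
      rw [eq_inv_of_mul_eq_one_left hi]
      exact inv_mem (Subgroup.npow_mem_zpowers x _)
  have hbij : Function.Bijective f :=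
    (Nat.bijective_iff_injective_and_card f).2
      ⟨hf, by rw [hG, Nat.card_eq_fintype_card, QuaternionGroup.card]⟩
  exact ⟨(MulEquiv.ofBijective f hbij).symm⟩

open Finset in
theorem stmt_15 {G : Type*} [Group G] [Finite G]
    (hpG : IsPGroup 2 G)
    (h : Nat.card {H : Subgroup G // IsCyclic H} = 5) :
    Nonempty (G ≃* QuaternionGroup 2) ∨
    Nonempty (G ≃* Multiplicative (ZMod 16)) := by
  classical
  have := Fintype.ofFinite G
  obtain ⟨n, hn⟩ := IsPGroup.iff_card.1 hpG
  set C : Finset (Subgroup G) := univ.image Subgroup.zpowers with hC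
  have hmemC (H : Subgroup G) : H ∈ C ↔ IsCyclic H := by
    simp [hC, Subgroup.isCyclic_iff_exists_zpowers_eq_top]
  have hC5 : #C = 5 := by rw [← h, Nat.subtype_card C hmemC]
  set c : ℕ → ℕ := fun k => #(C.filter fun H : Subgroup G => Nat.card H = 2 ^ k) with hc
  have hcount (k : ℕ) : #{g : G | orderOf g = 2 ^ k} = (2 ^ k).totient * c k :=
    card_orderOf_eq_totient_mul_card_zpowers _
  have hpos (k : ℕ) : 0 < c k ↔ ∃ g : G, orderOf g = 2 ^ k := by
    simp [hc, hC, card_pos, Finset.Nonempty, -Nat.card_eq_fintype_card, Nat.card_zpowers]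
  have horder (g : G) : ∃ k ≤ n, orderOf g = 2 ^ k :=
    (Nat.dvd_prime_pow Nat.prime_two).1 (hn ▸ orderOf_dvd_natCard g)
  have hc0 : c 0 = 1 := by
    have hone : ({g : G | orderOf g = 2 ^ 0} : Finset G) = {1} := by
      ext g
      simp
    have h0 := hcount 0
    rw [hone, card_singleton, pow_zero, Nat.totient_one, one_mul] at h0
    exact h0.symm
  have hdown (k : ℕ) (hk : 0 < c (k + 1)) : 0 < c k := by
    obtain ⟨g, hg⟩ := (hpos _).1 hk
    refine (hpos _).2 ⟨g ^ 2, ?_⟩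
    rw [orderOf_pow_of_dvd two_ne_zero (hg ▸ dvd_pow_self 2 k.succ_ne_zero), hg, pow_succ,
      Nat.mul_div_cancel _ two_pos]
  have hsumC : ∑ k ∈ range (n + 6), c k = 5 := by
    rw [← hC5, card_eq_sum_card_fiberwise (f := fun H : Subgroup G => Nat.log 2 (Nat.card H))
      (t := range (n + 6))]
    · refine sum_congr rfl fun k _ => congrArg card (filter_congr fun H hH => ?_)
      obtain ⟨g, -, rfl⟩ := mem_image.1 hH
      obtain ⟨j, -, hj⟩ := horder g
      simp [-Nat.card_eq_fintype_card, Nat.card_zpowers, hj]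
    · intro H hH
      obtain ⟨g, -, rfl⟩ := mem_image.1 hH
      obtain ⟨j, hjn, hj⟩ := horder g
      simp only [coe_range, Set.mem_Iio, Nat.card_zpowers, hj, Nat.log_pow one_lt_two]
      omega
  have hsumG : ∑ k ∈ range (n + 6), (2 ^ k).totient * c k = 2 ^ n := by
    rw [← hn, Nat.card_eq_fintype_card, ← card_univ,
      card_eq_sum_card_fiberwise (f := fun g : G => Nat.log 2 (orderOf g)) (t := range (n + 6))]
    · refine sum_congr rfl fun k _ => ?_
      rw [← hcount]
      refine congrArg card (filter_congr fun g _ => ?_)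
      obtain ⟨j, -, hj⟩ := horder g
      simp [hj]
    · intro g _
      obtain ⟨j, hjn, hj⟩ := horder g
      simp [hj]
      omega
  have hd1 : 0 < c 2 → 0 < c 1 := hdown 1
  have hd2 : 0 < c 3 → 0 < c 2 := hdown 2
  have hd3 : 0 < c 4 → 0 < c 3 := hdown 3
  have hd4 : 0 < c 5 → 0 < c 4 := hdown 4
  have hc5 : c 5 = 0 := by
    have hle : ∑ k ∈ range 6, c k ≤ ∑ k ∈ range (n + 6), c k :=
      sum_le_sum_of_subset (range_mono (by omega))
    rw [hsumC] at hle
    simp only [sum_range_succ, sum_range_zero] at hle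
    omega
  have hclarge (k : ℕ) : c (5 + k) = 0 := by
    induction k with
    | zero => exact hc5
    | succ k ih =>
      have := hdown (5 + k)
      rw [← add_assoc]
      omega
  have hsub : range 5 ⊆ range (n + 6) := range_mono (by omega)
  have hzero (k : ℕ) (hk : k ∉ range 5) : c k = 0 := by
    obtain ⟨j, rfl⟩ := Nat.exists_eq_add_of_le (not_lt.1 (mem_range.not.1 hk))
    exact hclarge j
  rw [← sum_subset hsub fun k _ hk => hzero k hk] at hsumC
  rw [← sum_subset hsub fun k _ hk => by rw [hzero k hk, mul_zero]] at hsumG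
  have ht4 : Nat.totient 4 = 2 := rfl
  have ht8 : Nat.totient 8 = 4 := rfl
  have ht16 : Nat.totient 16 = 8 := rfl
  norm_num [sum_range_succ, ht4, ht8, ht16] at hsumC hsumG hd1 hd2 hd3
  have hn6 : n < 6 := by
    rw [← Nat.pow_lt_pow_iff_right one_lt_two]
    omega
  have hcases : n = 3 ∧ c 1 = 1 ∧ c 2 = 3 ∧ c 3 = 0 ∨ n = 4 ∧ c 4 = 1 := by
    interval_cases n <;> omega
  obtain ⟨rfl, h1, h2, h3⟩ | ⟨rfl, h4⟩ := hcases
  · left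
    obtain ⟨x, hx⟩ := (hpos 2).1 (by omega)
    have hinv : #{g : G | orderOf g = 2} = 1 := by simpa [h1] using hcount 1
    have huniq {y z : G} (hy : orderOf y = 2) (hz : orderOf z = 2) : y = z :=
      card_le_one.1 hinv.le y (by simpa using hy) z (by simpa using hz)
    have hsq {y : G} (hy : orderOf y = 4) : orderOf (y ^ 2) = 2 := by
      rw [orderOf_pow_of_dvd two_ne_zero (by rw [hy]; norm_num), hy]
    norm_num at hx
    refine nonempty_mulEquiv_quaternionGroup_two hn hx fun y hy => ?_
    obtain ⟨k, hk, hyk⟩ := horder y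
    interval_cases k
    · rw [pow_zero, orderOf_eq_one_iff] at hyk
      exact absurd (hyk ▸ one_mem _) hy
    · rw [pow_one] at hyk
      exact absurd (huniq hyk (hsq hx) ▸ Subgroup.npow_mem_zpowers x 2) hy
    · exact huniq (hsq hyk) (hsq hx)
    · have := (hpos 3).2 ⟨y, hyk⟩
      omega
  · right
    obtain ⟨x, hx⟩ := (hpos 4).1 (by omega)
    have : IsCyclic G := isCyclic_of_orderOf_eq_card x (hx.trans hn.symm)
    exact ⟨mulEquivOfCyclicCardEq (by rw [hn]; simp)⟩
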